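/- arXiv:math/0407373 — 2 statements merged into one kernel-verified Lean document; each statement's English description precedes it below -/
import Mathlib

section
/- Let n ≥ 3 and let F be a family of subsets of {1,...,n} such that there are no four distinct members A, B, C, D ∈ F with A ∪ B ⊆ C ∩ D. Then |F| ≤ C(n, ⌊n/2⌋) + C(n, ⌊n/2⌋+1). -/
open Finset Numbering

section Prefixes

variable {α : Type*} [Fintype α]

lemma Numbering.IsPrefix.subset_or_subset {f : Numbering α} {s t : Finset α}
    (hs : f.IsPrefix s) (ht : f.IsPrefix t) : s ⊆ t ∨ t ⊆ s :=
  (le_total #s #t).imp (hs.subset_of_card_le_card ht) (ht.subset_of_card_le_card hs)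

lemma Numbering.IsPrefix.perm_trans {f : Numbering α} {s : Finset α} (hs : f.IsPrefix s)
    {π : Equiv.Perm α} (hπ : ∀ x, π x ∈ s ↔ x ∈ s) :
    IsPrefix (π.trans f : Numbering α) s := fun x ↦ by
  rw [← hπ x]; exact hs (π x)

lemma Numbering.IsPrefix.not_perm_trans {f : Numbering α} {s : Finset α} (hs : f.IsPrefix s)
    {π : Equiv.Perm α} {x : α} (hx : x ∈ s) (hπ : π x ∉ s) :
    ¬ IsPrefix (π.trans f : Numbering α) s := fun h ↦
  hπ ((hs (π x)).2 ((h x).1 hx))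

variable [DecidableEq α]

/-- The members of `F` that are initial segments of the numbering `f`. -/
def prefixMembers (F : Finset (Finset α)) (f : Numbering α) : Finset (Finset α) :=
  F.filter fun s ↦ f.IsPrefix s

lemma mem_prefixMembers {F : Finset (Finset α)} {f : Numbering α} {s : Finset α} :
    s ∈ prefixMembers F f ↔ s ∈ F ∧ f.IsPrefix s := by
  simp [prefixMembers]

lemma sum_card_prefixMembers (F : Finset (Finset α)) :
    (∑ f : Numbering α, (#(prefixMembers F f) : ℚ)) =
      (Fintype.card α).factorial * ∑ s ∈ F, ((Fintype.card α).choose #s : ℚ)⁻¹ := by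
  have h : ∑ f : Numbering α, #(prefixMembers F f) = ∑ s ∈ F, #(prefixed s) := by
    simp only [prefixMembers, prefixed, card_filter]
    exact sum_comm
  rw [← Nat.cast_sum, h, Nat.cast_sum, mul_sum]
  refine sum_congr rfl fun s _ ↦ ?_
  rw [card_prefixed, Nat.cast_choose ℚ s.card_le_univ]
  have := Nat.factorial_ne_zero (Fintype.card α)
  push_cast
  field_simp

/-- If the numberings related to `B` by `P` can be turned, by a permutation depending on `B` only,
into numberings whose only prefix in `F` is `B`, then there are at least as many numberings with
exactly one prefix in `F` as numberings related to some `B`. -/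
lemma card_le_card_prefixMembers_eq_one (F : Finset (Finset α))
    (P : Numbering α → Finset α → Prop) (T : Finset (Numbering α))
    (hT : ∀ f ∈ T, ∃ B, P f B)
    (hP : ∀ B, ∃ π : Equiv.Perm α, ∀ f, P f B → prefixMembers F (π.trans f) = {B}) :
    #T ≤ #{f : Numbering α | #(prefixMembers F f) = 1} := by
  choose π hπ using hP
  choose! b hb using hT
  refine card_le_card_of_injOn (fun f ↦ (π (b f)).trans f) (fun f hf ↦ ?_) fun f hf g hg h ↦ ?_
  · simp [hπ _ _ (hb f hf)]
  · have hB : b f = b g := by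
      have h' := congrArg (prefixMembers F) h
      simpa [hπ _ _ (hb f hf), hπ _ _ (hb g hg)] using h'
    ext1 x
    have := congrArg (fun e : Numbering α ↦ e ((π (b f)).symm x)) h
    simpa [hB] using this

lemma exists_perm_prefixMembers_eq_of_between {F : Finset (Finset α)} (hbot : ∅ ∉ F)
    (htop : univ ∉ F)
    (hF : ∀ A ∈ F, ∀ B ∈ F, ∀ C ∈ F, ∀ D ∈ F,
      A ≠ B → A ≠ C → A ≠ D → B ≠ C → B ≠ D → C ≠ D → ¬ (A ∪ B ⊆ C ∩ D)) (B : Finset α) :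
    ∃ π : Equiv.Perm α, ∀ f : Numbering α,
      (B ∈ prefixMembers F f ∧ (∃ A ∈ prefixMembers F f, A ⊂ B) ∧
        ∃ C ∈ prefixMembers F f, B ⊂ C) → prefixMembers F (π.trans f) = {B} := by
  by_cases h : B ∈ F ∧ (∃ A ∈ F, A ⊂ B) ∧ ∃ C ∈ F, B ⊂ C
  swap
  · refine ⟨1, fun f hf ↦ (h ?_).elim⟩
    obtain ⟨hB, ⟨A, hA, hAB⟩, C, hC, hBC⟩ := hf
    simp only [mem_prefixMembers] at hA hB hC
    exact ⟨hB.1, ⟨A, hA.1, hAB⟩, C, hC.1, hBC⟩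
  obtain ⟨hB, ⟨A, hA, hAB⟩, C, hC, hBC⟩ := h
  have uA : ∀ E ∈ F, E ⊂ B → E = A := fun E hE hEB ↦ by
    by_contra hne
    exact hF E hE A hA B hB C hC hne hEB.ne (hEB.trans hBC).ne hAB.ne (hAB.trans hBC).ne hBC.ne
      (union_subset (subset_inter hEB.subset (hEB.trans hBC).subset)
        (subset_inter hAB.subset (hAB.trans hBC).subset))
  have uC : ∀ E ∈ F, B ⊂ E → E = C := fun E hE hBE ↦ by
    by_contra hne
    exact hF A hA B hB E hE C hC hAB.ne (hAB.trans hBE).ne (hAB.trans hBC).ne hBE.ne hBC.ne hne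
      (union_subset (subset_inter (hAB.trans hBE).subset (hAB.trans hBC).subset)
        (subset_inter hBE.subset hBC.subset))
  obtain ⟨a, ha⟩ : A.Nonempty := nonempty_iff_ne_empty.2 fun h ↦ hbot (h ▸ hA)
  obtain ⟨b, hb, hbA⟩ := exists_of_ssubset hAB
  obtain ⟨c, hc, hcB⟩ := exists_of_ssubset hBC
  obtain ⟨d, hd⟩ : ∃ d, d ∉ C := by
    by_contra! h
    exact htop (eq_univ_of_forall h ▸ hC)
  have haB := hAB.subset ha
  have hdB : d ∉ B := fun h ↦ hd (hBC.subset h)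
  refine ⟨Equiv.swap a b * Equiv.swap c d, ?_⟩
  rintro f ⟨hBf, ⟨A', hA', hAB'⟩, C', hC', hBC'⟩
  simp only [mem_prefixMembers] at hA' hBf hC'
  obtain rfl := uA A' hA'.1 hAB'
  obtain rfl := uC C' hC'.1 hBC'
  have hπa : (Equiv.swap a b * Equiv.swap c d) a = b := by
    rw [Equiv.Perm.mul_apply, Equiv.swap_apply_of_ne_of_ne
      (ne_of_mem_of_not_mem haB hcB) (ne_of_mem_of_not_mem haB hdB), Equiv.swap_apply_left]
  have hπc : (Equiv.swap a b * Equiv.swap c d) c = d := by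
    rw [Equiv.Perm.mul_apply, Equiv.swap_apply_left,
      Equiv.swap_apply_of_ne_of_ne (ne_of_mem_of_not_mem haB hdB).symm
        (ne_of_mem_of_not_mem hb hdB).symm]
  have hπB : ∀ x, (Equiv.swap a b * Equiv.swap c d) x ∈ B ↔ x ∈ B := fun x ↦ by
    simp only [Equiv.Perm.mul_apply, Equiv.swap_apply_def]
    clear hF uA uC
    grind
  have hpB := hBf.2.perm_trans hπB
  refine eq_singleton_iff_unique_mem.2 ⟨mem_prefixMembers.2 ⟨hB, hpB⟩, fun E hE ↦ ?_⟩
  rw [mem_prefixMembers] at hE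
  by_contra hne
  obtain hEB | hBE := hE.2.subset_or_subset hpB
  · obtain rfl := uA E hE.1 (hEB.ssubset_of_ne hne)
    exact hA'.2.not_perm_trans ha (by rwa [hπa]) hE.2
  · obtain rfl := uC E hE.1 (hBE.ssubset_of_ne (Ne.symm hne))
    exact hC'.2.not_perm_trans hc (by rwa [hπc]) hE.2

lemma exists_perm_prefixMembers_eq_of_below {F : Finset (Finset α)} (htop : univ ∉ F)
    (hF : ∀ A ∈ F, ∀ C ∈ F, ∀ D ∈ F, A ≠ C → A ≠ D → C ≠ D → ¬ (A ⊆ C ∩ D)) (A : Finset α) :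
    ∃ π : Equiv.Perm α, ∀ f : Numbering α,
      (A ∈ prefixMembers F f ∧ ∃ C ∈ prefixMembers F f, A ⊂ C) →
        prefixMembers F (π.trans f) = {A} := by
  by_cases h : A ∈ F ∧ ∃ C ∈ F, A ⊂ C
  swap
  · refine ⟨1, fun f hf ↦ (h ?_).elim⟩
    obtain ⟨hA, C, hC, hAC⟩ := hf
    simp only [mem_prefixMembers] at hA hC
    exact ⟨hA.1, C, hC.1, hAC⟩
  obtain ⟨hA, C, hC, hAC⟩ := h
  have uC : ∀ E ∈ F, A ⊂ E → E = C := fun E hE hAE ↦ by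
    by_contra hne
    exact hF A hA E hE C hC hAE.ne hAC.ne hne (subset_inter hAE.subset hAC.subset)
  have hmin : ∀ E ∈ F, ¬ E ⊂ A := fun E hE hEA ↦
    hF E hE A hA C hC hEA.ne (hEA.trans hAC).ne hAC.ne
      (subset_inter hEA.subset (hEA.trans hAC).subset)
  obtain ⟨c, hc, hcA⟩ := exists_of_ssubset hAC
  obtain ⟨d, hd⟩ : ∃ d, d ∉ C := by
    by_contra! h
    exact htop (eq_univ_of_forall h ▸ hC)
  have hdA : d ∉ A := fun h ↦ hd (hAC.subset h)
  refine ⟨Equiv.swap c d, ?_⟩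
  rintro f ⟨hAf, C', hC', hAC'⟩
  simp only [mem_prefixMembers] at hAf hC'
  obtain rfl := uC C' hC'.1 hAC'
  have hπA : ∀ x, Equiv.swap c d x ∈ A ↔ x ∈ A := fun x ↦ by
    simp only [Equiv.swap_apply_def]
    clear hF uC
    grind
  have hpA := hAf.2.perm_trans hπA
  refine eq_singleton_iff_unique_mem.2 ⟨mem_prefixMembers.2 ⟨hA, hpA⟩, fun E hE ↦ ?_⟩
  rw [mem_prefixMembers] at hE
  by_contra hne
  obtain hEA | hAE := hE.2.subset_or_subset hpA
  · exact hmin E hE.1 (hEA.ssubset_of_ne hne)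
  · obtain rfl := uC E hE.1 (hAE.ssubset_of_ne (Ne.symm hne))
    exact hC'.2.not_perm_trans hc (by rwa [Equiv.swap_apply_left]) hE.2

/-- Two or more prefixes of a numbering have a least and a greatest member, which differ. -/
lemma exists_ssubset_prefixMembers {F : Finset (Finset α)} {f : Numbering α}
    (h : 1 < #(prefixMembers F f)) :
    ∃ A ∈ prefixMembers F f, ∃ C ∈ prefixMembers F f, A ⊂ C ∧
      ∀ B ∈ prefixMembers F f, A ⊆ B ∧ B ⊆ C := by
  have hne : (prefixMembers F f).Nonempty := card_pos.1 (by omega)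
  obtain ⟨A, hA, hmin⟩ := exists_min_image (prefixMembers F f) card hne
  obtain ⟨C, hC, hmax⟩ := exists_max_image (prefixMembers F f) card hne
  have hAC : ∀ B ∈ prefixMembers F f, A ⊆ B ∧ B ⊆ C := fun B hB ↦
    ⟨(mem_prefixMembers.1 hA).2.subset_of_card_le_card (mem_prefixMembers.1 hB).2 (hmin B hB),
      (mem_prefixMembers.1 hB).2.subset_of_card_le_card (mem_prefixMembers.1 hC).2 (hmax B hB)⟩
  refine ⟨A, hA, C, hC, (hAC A hA).2.ssubset_of_ne ?_, hAC⟩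
  rintro rfl
  obtain ⟨X, hX, Y, hY, hXY⟩ := one_lt_card.1 h
  exact hXY (((hAC X hX).2.antisymm (hAC X hX).1).trans ((hAC Y hY).1.antisymm (hAC Y hY).2))

lemma exists_between_prefixMembers {F : Finset (Finset α)} {f : Numbering α}
    (h : 2 < #(prefixMembers F f)) :
    ∃ B ∈ prefixMembers F f, (∃ A ∈ prefixMembers F f, A ⊂ B) ∧
      ∃ C ∈ prefixMembers F f, B ⊂ C := by
  obtain ⟨A, hA, C, hC, -, hAC⟩ := exists_ssubset_prefixMembers (F := F) (f := f) (by omega)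
  obtain ⟨B, hB, hBn⟩ := exists_mem_notMem_of_card_lt_card
    ((card_le_two (a := A) (b := C)).trans_lt h)
  simp only [mem_insert, mem_singleton, not_or] at hBn
  exact ⟨B, hB, ⟨A, hA, (hAC B hB).1.ssubset_of_ne (Ne.symm hBn.1)⟩, C, hC,
    (hAC B hB).2.ssubset_of_ne hBn.2⟩

lemma card_prefixMembers_le_three {F : Finset (Finset α)}
    (hF : ∀ A ∈ F, ∀ B ∈ F, ∀ C ∈ F, ∀ D ∈ F,
      A ≠ B → A ≠ C → A ≠ D → B ≠ C → B ≠ D → C ≠ D → ¬ (A ∪ B ⊆ C ∩ D)) (f : Numbering α) :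
    #(prefixMembers F f) ≤ 3 := by
  by_contra! h
  obtain ⟨A, hA, D, hD, -, hAD⟩ := exists_ssubset_prefixMembers (F := F) (f := f) (by omega)
  have h2 : 1 < #(prefixMembers F f \ {A, D}) := by
    have := le_card_sdiff {A, D} (prefixMembers F f)
    have := card_le_two (a := A) (b := D)
    omega
  obtain ⟨B, hB, C, hC, hBC⟩ := one_lt_card.1 h2
  simp only [mem_sdiff, mem_insert, mem_singleton, not_or] at hB hC
  have key : ∀ B ∈ prefixMembers F f, ∀ C ∈ prefixMembers F f, B ≠ C → B ≠ A → B ≠ D → C ≠ A →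
      C ≠ D → ¬ B ⊆ C := fun B hB C hC hBC hBA hBD hCA hCD hsub ↦
    hF A (mem_prefixMembers.1 hA).1 B (mem_prefixMembers.1 hB).1 C (mem_prefixMembers.1 hC).1
      D (mem_prefixMembers.1 hD).1 hBA.symm hCA.symm
      (fun h ↦ hBA ((h ▸ (hAD B hB).2).antisymm (hAD B hB).1)) hBC hBD hCD
      (union_subset (subset_inter (hAD C hC).1 (hAD D hD).1) (subset_inter hsub (hAD B hB).2))
  obtain hsub | hsub :=
    (mem_prefixMembers.1 hB.1).2.subset_or_subset (mem_prefixMembers.1 hC.1).2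
  · exact key B hB.1 C hC.1 hBC hB.2.1 hB.2.2 hC.2.1 hC.2.2 hsub
  · exact key C hC.1 B hB.1 hBC.symm hC.2.1 hC.2.2 hB.2.1 hB.2.2 hsub

lemma sum_inv_choose_le_two {F : Finset (Finset α)} (hbot : ∅ ∉ F) (htop : univ ∉ F)
    (hF : ∀ A ∈ F, ∀ B ∈ F, ∀ C ∈ F, ∀ D ∈ F,
      A ≠ B → A ≠ C → A ≠ D → B ≠ C → B ≠ D → C ≠ D → ¬ (A ∪ B ⊆ C ∩ D)) :
    ∑ s ∈ F, ((Fintype.card α).choose #s : ℚ)⁻¹ ≤ 2 := by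
  have hT := card_le_card_prefixMembers_eq_one F _
    {f : Numbering α | #(prefixMembers F f) = 3}
    (fun f hf ↦ exists_between_prefixMembers (by simp at hf; omega))
    (exists_perm_prefixMembers_eq_of_between hbot htop hF)
  have hsum : ∑ f : Numbering α, #(prefixMembers F f) +
      #{f : Numbering α | #(prefixMembers F f) = 1} ≤
      ∑ f : Numbering α, 2 + #{f : Numbering α | #(prefixMembers F f) = 3} := by
    rw [card_filter, card_filter, ← sum_add_distrib, ← sum_add_distrib]
    refine sum_le_sum fun f _ ↦ ?_
    have := card_prefixMembers_le_three hF f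
    split_ifs <;> omega
  have hle : ∑ f : Numbering α, #(prefixMembers F f) ≤ (Fintype.card α).factorial * 2 := by
    simp only [sum_const, card_univ, Fintype.card_numbering, smul_eq_mul] at hsum
    omega
  have hle' := (Nat.cast_le (α := ℚ)).2 hle
  push_cast at hle'
  rw [sum_card_prefixMembers] at hle'
  exact le_of_mul_le_mul_left hle' (by positivity)

lemma two_mul_sum_inv_choose_le_three {F : Finset (Finset α)} (htop : univ ∉ F)
    (hF : ∀ A ∈ F, ∀ C ∈ F, ∀ D ∈ F, A ≠ C → A ≠ D → C ≠ D → ¬ (A ⊆ C ∩ D)) :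
    2 * ∑ s ∈ F, ((Fintype.card α).choose #s : ℚ)⁻¹ ≤ 3 := by
  have hcard (f : Numbering α) : #(prefixMembers F f) ≤ 2 := by
    by_contra! h
    obtain ⟨B, hB, ⟨A, hA, hAB⟩, C, hC, hBC⟩ := exists_between_prefixMembers h
    exact hF A (mem_prefixMembers.1 hA).1 B (mem_prefixMembers.1 hB).1 C (mem_prefixMembers.1 hC).1
      hAB.ne (hAB.trans hBC).ne hBC.ne (subset_inter hAB.subset (hAB.trans hBC).subset)
  have hT := card_le_card_prefixMembers_eq_one F _
    {f : Numbering α | #(prefixMembers F f) = 2}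
    (fun f hf ↦ by
      obtain ⟨A, hA, C, hC, hAC, -⟩ := exists_ssubset_prefixMembers
        (F := F) (f := f) (by simp at hf; omega)
      exact ⟨A, hA, C, hC, hAC⟩)
    (exists_perm_prefixMembers_eq_of_below htop hF)
  have hsum : ∑ f : Numbering α, 2 * #(prefixMembers F f) +
      #{f : Numbering α | #(prefixMembers F f) = 1} ≤
      ∑ f : Numbering α, 3 + #{f : Numbering α | #(prefixMembers F f) = 2} := by
    rw [card_filter, card_filter, ← sum_add_distrib, ← sum_add_distrib]
    refine sum_le_sum fun f _ ↦ ?_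
    have := hcard f
    split_ifs <;> omega
  have hle : 2 * ∑ f : Numbering α, #(prefixMembers F f) ≤ (Fintype.card α).factorial * 3 := by
    simp only [sum_const, card_univ, Fintype.card_numbering, smul_eq_mul, ← mul_sum] at hsum
    omega
  have hle' := (Nat.cast_le (α := ℚ)).2 hle
  push_cast at hle'
  rw [sum_card_prefixMembers, mul_left_comm] at hle'
  exact le_of_mul_le_mul_left hle' (by positivity)

end Prefixes

lemma Nat.choose_le_choose_half_succ {n k : ℕ} (hk : k ≠ n / 2) (hkn : k ≤ n) (hn : n ≠ 0) :
    n.choose k ≤ n.choose (n / 2 + 1) := by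
  have mono : ∀ m, m ≤ n / 2 → ∀ j, j ≤ m → n.choose j ≤ n.choose m := fun m hm j hj ↦ by
    induction m, hj using Nat.le_induction with
    | base => rfl
    | succ m _ ih => exact (ih (by omega)).trans (Nat.choose_le_succ_of_lt_half_left (by omega))
  rw [← Nat.choose_symm (by omega : n / 2 + 1 ≤ n)]
  obtain h | h := Nat.lt_or_gt_of_ne hk
  · exact mono _ (by omega) _ (by omega)
  · rw [← Nat.choose_symm hkn]
    exact mono _ (by omega) _ (by omega)

lemma Nat.choose_half_add_two_le {n : ℕ} (hn : 3 ≤ n) :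
    n.choose (n / 2) + 2 ≤ 2 * n.choose (n / 2 + 1) := by
  have hM : n ≤ n.choose (n / 2) := by simpa using Nat.choose_le_middle 1 n
  obtain ⟨m, rfl | rfl⟩ := n.even_or_odd'
  · have h := Nat.choose_succ_right_eq (2 * m) m
    rw [Nat.mul_div_cancel_left m two_pos] at *
    rw [show 2 * m - m = m by omega] at h
    obtain rfl | hm := eq_or_ne m 2
    · decide
    · have : 3 ≤ m := by omega
      nlinarith
  · rw [show (2 * m + 1) / 2 = m by omega] at *
    rw [Nat.choose_symm_half]
    omega

lemma card_le_of_sum_inv_choose_le_two {n : ℕ} (hn : 1 < n) {F : Finset (Finset (Fin n))}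
    (h : ∑ s ∈ F, (n.choose #s : ℚ)⁻¹ ≤ 2) :
    #F ≤ n.choose (n / 2) + n.choose (n / 2 + 1) := by
  set M := n.choose (n / 2) with hM
  set N := n.choose (n / 2 + 1) with hN
  have hM0 : (0 : ℚ) < M := by exact_mod_cast Nat.choose_pos (by omega)
  have hN0 : (0 : ℚ) < N := by exact_mod_cast Nat.choose_pos (by omega)
  have hNM : (N : ℚ) ≤ M := by exact_mod_cast Nat.choose_le_middle _ n
  have hL : (#{s ∈ F | #s = n / 2} : ℚ) ≤ M := by
    have : #{s ∈ F | #s = n / 2} ≤ #(powersetCard (n / 2) (univ : Finset (Fin n))) :=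
      card_le_card fun s hs ↦ by simp_all
    rw [card_powersetCard, card_univ, Fintype.card_fin] at this
    exact_mod_cast this
  have hcard := card_filter_add_card_filter_not (s := F) (fun s ↦ #s = n / 2)
  rw [← sum_filter_add_sum_filter_not F (fun s ↦ #s = n / 2)] at h
  have h₁ : ∑ s ∈ F with #s = n / 2, (n.choose #s : ℚ)⁻¹ = #{s ∈ F | #s = n / 2} * (M : ℚ)⁻¹ := by
    rw [← nsmul_eq_mul, ← sum_const]
    exact sum_congr rfl fun s hs ↦ by rw [(mem_filter.1 hs).2]
  have h₂ : #{s ∈ F | ¬ #s = n / 2} * (N : ℚ)⁻¹ ≤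
      ∑ s ∈ F with ¬ #s = n / 2, (n.choose #s : ℚ)⁻¹ := by
    rw [← nsmul_eq_mul]
    refine card_nsmul_le_sum _ _ _ fun s hs ↦ ?_
    have hsn : #s ≤ n := by simpa using s.card_le_univ
    have : 0 < n.choose #s := Nat.choose_pos hsn
    gcongr
    exact Nat.choose_le_choose_half_succ (mem_filter.1 hs).2 hsn (by omega)
  rw [← hcard]
  set L := #{s ∈ F | #s = n / 2}
  set R := #{s ∈ F | ¬ #s = n / 2}
  have h₃ : (L : ℚ) * (M : ℚ)⁻¹ + R * (N : ℚ)⁻¹ ≤ 2 := by linarith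
  have h₄ : (L : ℚ) * N + R * M ≤ 2 * (M * N) := by
    have := mul_le_mul_of_nonneg_right h₃ (mul_pos hM0 hN0).le
    field_simp at this
    linarith
  have h₅ : (L : ℚ) + R ≤ M + N := by
    refine le_of_mul_le_mul_right ?_ hM0
    nlinarith [mul_nonneg (sub_nonneg.2 hL) (sub_nonneg.2 hNM)]
  exact_mod_cast h₅

lemma two_mul_card_le_of_two_mul_sum_inv_choose_le_three {n : ℕ} {F : Finset (Finset (Fin n))}
    (h : 2 * ∑ s ∈ F, (n.choose #s : ℚ)⁻¹ ≤ 3) :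
    2 * #F ≤ 3 * n.choose (n / 2) := by
  have hM0 : (0 : ℚ) < n.choose (n / 2) := by exact_mod_cast Nat.choose_pos (by omega)
  have h₂ : #F * (n.choose (n / 2) : ℚ)⁻¹ ≤ ∑ s ∈ F, (n.choose #s : ℚ)⁻¹ := by
    rw [← nsmul_eq_mul]
    refine card_nsmul_le_sum _ _ _ fun s _ ↦ ?_
    have : 0 < n.choose #s := Nat.choose_pos (by simpa using s.card_le_univ)
    gcongr
    exact Nat.choose_le_middle _ n
  have h₃ : 2 * (#F * (n.choose (n / 2) : ℚ)⁻¹) ≤ 3 := by linarith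
  have h₄ := mul_le_mul_of_nonneg_right h₃ hM0.le
  field_simp at h₄
  rw [mul_comm 3]
  exact_mod_cast h₄

lemma card_le_of_empty_mem {n : ℕ} (hn : 3 ≤ n) {F : Finset (Finset (Fin n))}
    (hF : ∀ A ∈ F, ∀ B ∈ F, ∀ C ∈ F, ∀ D ∈ F,
      A ≠ B → A ≠ C → A ≠ D → B ≠ C → B ≠ D → C ≠ D → ¬ (A ∪ B ⊆ C ∩ D)) (hbot : ∅ ∈ F) :
    #F ≤ n.choose (n / 2) + n.choose (n / 2 + 1) := by
  have hMN := Nat.choose_half_add_two_le hn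
  have hcard := card_erase_add_one hbot
  have hV : ∀ A ∈ F.erase ∅, ∀ C ∈ F.erase ∅, ∀ D ∈ F.erase ∅,
      A ≠ C → A ≠ D → C ≠ D → ¬ (A ⊆ C ∩ D) := fun A hA C hC D hD hAC hAD hCD hsub ↦ by
    simp only [mem_erase] at hA hC hD
    exact hF ∅ hbot A hA.2 C hC.2 D hD.2 hA.1.symm hC.1.symm hD.1.symm hAC hAD hCD (by simpa)
  by_cases htop : univ ∈ F
  · have htop' : univ ∈ F.erase ∅ :=
      mem_erase.2 ⟨(univ_nonempty_iff.2 ⟨⟨0, by omega⟩⟩).ne_empty, htop⟩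
    have hcard' := card_erase_add_one htop'
    have hanti : IsAntichain (· ⊆ ·)
        (((F.erase ∅).erase univ : Finset (Finset (Fin n))) : Set (Finset (Fin n))) := by
      intro A hA C hC hAC hsub
      simp only [mem_coe, mem_erase] at hA hC
      exact hV A (mem_erase.2 hA.2) C (mem_erase.2 hC.2) univ htop' hAC hA.1 hC.1 (by simpa)
    have := hanti.sperner
    rw [Fintype.card_fin] at this
    have hM : n ≤ n.choose (n / 2) := by simpa using Nat.choose_le_middle 1 n
    omega
  · have := two_mul_sum_inv_choose_le_three (fun h ↦ htop (mem_of_mem_erase h)) hV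
    rw [Fintype.card_fin] at this
    have := two_mul_card_le_of_two_mul_sum_inv_choose_le_three this
    omega

theorem stmt_0 (n : ℕ) (hn : 3 ≤ n) (F : Finset (Finset (Fin n)))
    (hstar : ∀ A ∈ F, ∀ B ∈ F, ∀ C ∈ F, ∀ D ∈ F,
      A ≠ B → A ≠ C → A ≠ D → B ≠ C → B ≠ D → C ≠ D → ¬ (A ∪ B ⊆ C ∩ D)) :
    F.card ≤ n.choose (n / 2) + n.choose (n / 2 + 1) := by
  by_cases hbot : ∅ ∈ F
  · exact card_le_of_empty_mem hn hstar hbot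
  by_cases htop : univ ∈ F
  · rw [← card_image_of_injective F compl_injective]
    refine card_le_of_empty_mem hn ?_ (mem_image.2 ⟨univ, htop, by simp⟩)
    simp only [forall_mem_image]
    intro A hA B hB C hC D hD hAB hAC hAD hBC hBD hCD hsub
    rw [← compl_inter, ← compl_union, compl_subset_compl] at hsub
    exact hstar C hC D hD A hA B hB (by grind) (by grind) (by grind) (by grind) (by grind)
      (by grind) hsub
  · have := sum_inv_choose_le_two hbot htop hstar
    rw [Fintype.card_fin] at this
    exact card_le_of_sum_inv_choose_le_two (by omega) this
end

section
/- Let n ≥ 5 and let F be a family of subsets of {1,...,n} with ∅, [n] ∉ F and no four distinct members A, B, C, D with A ∪ B ⊆ C ∩ D. If Σ_{F∈F} 1/C(n,|F|) = 2, then F consists of all subsets of size k and all subsets of size k+1 for some k with 1 ≤ k ≤ n−2. -/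
open Finset

/-- No four distinct members `A, B, C, D` of the family satisfy `A ∪ B ⊆ C ∩ D`. -/
def ButterflyFree {X : Type*} [DecidableEq X] (F : Finset (Finset X)) : Prop :=
  ∀ A ∈ F, ∀ B ∈ F, ∀ C ∈ F, ∀ D ∈ F,
    A ≠ B → A ≠ C → A ≠ D → B ≠ C → B ≠ D → C ≠ D → ¬ (A ∪ B ⊆ C ∩ D)

/-- The permutation of `Fin N` rotating `{0, …, b - 1}` and `{b, …, N - 1}` separately by one. -/
def splitRotate {N : ℕ} (b : Fin N) : Equiv.Perm (Fin N) where
  toFun i := ⟨if i.1 < b.1 then (if i.1 + 1 < b.1 then i.1 + 1 else 0)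
    else (if i.1 + 1 < N then i.1 + 1 else b.1), by split_ifs <;> omega⟩
  invFun i := ⟨if i.1 < b.1 then (if i.1 = 0 then b.1 - 1 else i.1 - 1)
    else (if i.1 = b.1 then N - 1 else i.1 - 1), by split_ifs <;> omega⟩
  left_inv i := by
    ext
    grind
  right_inv i := by
    ext
    grind

lemma splitRotate_val {N : ℕ} (b i : Fin N) : (splitRotate b i).1 =
    if i.1 < b.1 then (if i.1 + 1 < b.1 then i.1 + 1 else 0)
      else (if i.1 + 1 < N then i.1 + 1 else b.1) := rfl

lemma splitRotate_lt_iff {N : ℕ} (b i : Fin N) : splitRotate b i < b ↔ i < b := by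
  rw [Fin.lt_def, Fin.lt_def, splitRotate_val]
  split_ifs <;> omega

lemma splitRotate_not_preserves {N : ℕ} {b : Fin N} {a : ℕ} (ha : 0 < a) (hab : a ≠ b.1)
    (haN : a < N) : ¬ ∀ i : Fin N, (splitRotate b i).1 < a ↔ i.1 < a := by
  intro h
  have := h ⟨a - 1, by omega⟩
  rw [splitRotate_val] at this
  dsimp only at this
  split_ifs at this <;> omega

lemma splitRotate_val_of_ne {N : ℕ} {b i : Fin N} (hb : i.1 + 1 ≠ b.1) (hN : i.1 + 1 ≠ N) :
    (splitRotate b i).1 = i.1 + 1 := by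
  rw [splitRotate_val]
  split_ifs <;> omega

lemma eq_of_splitRotate_sq_preserves {N : ℕ} {b : Fin N} {a : ℕ} (ha : 0 < a) (hab : a ≠ b.1)
    (haN : a < N) (h : ∀ i : Fin N, (splitRotate b (splitRotate b i)).1 < a ↔ i.1 < a) :
    (a + 1 = b.1 ∨ a + 1 = N) ∧ (a = 1 ∨ a = b.1 + 1) := by
  constructor
  · by_contra! hne
    have h₁ := splitRotate_val_of_ne (b := b) (i := ⟨a - 1, by omega⟩)
      (by dsimp only; omega) (by dsimp only; omega)
    dsimp only at h₁
    have h₂ := splitRotate_val_of_ne (b := b) (i := splitRotate b ⟨a - 1, by omega⟩)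
      (by omega) (by omega)
    have := (h ⟨a - 1, by omega⟩).2 (by dsimp only; omega)
    omega
  · by_contra! hne
    have h₁ := splitRotate_val_of_ne (b := b) (i := ⟨a - 2, by omega⟩)
      (by dsimp only; omega) (by dsimp only; omega)
    dsimp only at h₁
    have h₂ := splitRotate_val_of_ne (b := b) (i := splitRotate b ⟨a - 2, by omega⟩)
      (by omega) (by omega)
    have := (h ⟨a - 2, by omega⟩).2 (by dsimp only; omega)
    omega

lemma mclosure_adjacent_swap (N : ℕ) : Submonoid.closure
    {e : Equiv.Perm (Fin N) | ∃ i j : Fin N, i.1 + 1 = j.1 ∧ e = Equiv.swap i j} = ⊤ := by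
  cases N with
  | zero => exact Subsingleton.elim _ _
  | succ N =>
    rw [eq_top_iff, ← Equiv.Perm.mclosure_swap_castSucc_succ N]
    refine Submonoid.closure_mono ?_
    rintro _ ⟨i, rfl⟩
    exact ⟨i.castSucc, i.succ, by simp, rfl⟩

namespace Numbering

variable {X : Type*} [Fintype X]

/-- The first `i` elements in the numbering `f`. -/
def initial (f : Numbering X) (i : ℕ) : Finset X := {x | (f x).1 < i}

@[simp] lemma mem_initial {f : Numbering X} {i : ℕ} {x : X} :
    x ∈ f.initial i ↔ (f x).1 < i := by simp [initial]

lemma card_initial (f : Numbering X) {i : ℕ} (hi : i ≤ Fintype.card X) : #(f.initial i) = i := by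
  have h : (f.initial i).map f.toEmbedding = ({j : Fin (Fintype.card X) | j.1 < i} : Finset _) := by
    ext j
    simp only [mem_map_equiv, mem_initial, Equiv.apply_symm_apply, mem_filter, mem_univ, true_and]
  rw [← card_map f.toEmbedding, h, Fin.card_filter_val_lt, min_eq_right hi]

lemma initial_mono (f : Numbering X) {i j : ℕ} (h : i ≤ j) : f.initial i ⊆ f.initial j :=
  fun _ hx ↦ mem_initial.2 ((mem_initial.1 hx).trans_le h)

lemma isPrefix_iff {f : Numbering X} {s : Finset X} : f.IsPrefix s ↔ f.initial #s = s := by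
  simp only [IsPrefix, Finset.ext_iff, mem_initial]
  exact forall_congr' fun _ ↦ Iff.comm

lemma initial_trans_eq_iff {f : Numbering X} {e : Equiv.Perm (Fin (Fintype.card X))} {i : ℕ} :
    initial (f.trans e) i = f.initial i ↔ ∀ j, (e j).1 < i ↔ j.1 < i := by
  simp only [Finset.ext_iff, mem_initial, Equiv.trans_apply]
  exact f.forall_congr_left.trans (by simp)

lemma initial_ne (f g : Numbering X) {i j : ℕ} (hi : i ≤ Fintype.card X) (hj : j ≤ Fintype.card X)
    (h : i ≠ j) : f.initial i ≠ g.initial j := fun e ↦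
  h (by rw [← card_initial f hi, e, card_initial g hj])

variable [DecidableEq X]

lemma exists_initial_eq (s : Finset X) : ∃ f : Numbering X, f.initial #s = s := by
  have h : 0 < #(prefixed s) := by rw [card_prefixed]; positivity
  obtain ⟨f, hf⟩ := card_pos.1 h
  exact ⟨f, isPrefix_iff.1 (mem_prefixed.1 hf)⟩

/-- The sizes of the members of `F` that are prefixes of `f`. -/
def profile (F : Finset (Finset X)) (f : Numbering X) : Finset ℕ :=
  {i ∈ range (Fintype.card X + 1) | f.initial i ∈ F}

variable {F : Finset (Finset X)} {f g : Numbering X} {a b c i : ℕ}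

lemma mem_profile : i ∈ profile F f ↔ i ≤ Fintype.card X ∧ f.initial i ∈ F := by
  simp [profile]

lemma card_profile (F : Finset (Finset X)) (f : Numbering X) :
    #(profile F f) = #{s ∈ F | f ∈ prefixed s} := by
  refine card_bij' (fun i _ ↦ f.initial i) (fun s _ ↦ #s) ?_ ?_ ?_ ?_
  · intro i hi
    rw [mem_profile] at hi
    simp [hi.2, isPrefix_iff, card_initial f hi.1]
  · intro s hs
    simp only [mem_filter, mem_prefixed, isPrefix_iff] at hs
    simp [mem_profile, hs.2, hs.1, card_le_univ]
  · intro i hi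
    exact card_initial f (mem_profile.1 hi).1
  · intro s hs
    simp only [mem_filter, mem_prefixed, isPrefix_iff] at hs
    exact hs.2

lemma sum_card_profile (F : Finset (Finset X)) :
    ∑ f : Numbering X, (#(profile F f) : ℚ) =
      (Fintype.card (Numbering X) : ℚ) * ∑ s ∈ F, (1 : ℚ) / ((Fintype.card X).choose #s) := by
  have h (s : Finset X) : (#(prefixed s) : ℚ) =
      (Fintype.card (Numbering X) : ℚ) * (1 / ((Fintype.card X).choose #s)) := by
    rw [card_prefixed, Fintype.card_numbering, Nat.cast_choose ℚ s.card_le_univ]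
    push_cast
    field_simp
  rw [mul_sum, ← sum_congr rfl fun s _ ↦ h s]
  simp_rw [card_profile]
  norm_cast
  simp_rw [card_filter]
  rw [sum_comm]
  simp [prefixed]

lemma card_profile_le_three (hF : ButterflyFree F) (f : Numbering X) : #(profile F f) ≤ 3 := by
  by_contra! h
  obtain ⟨e, he⟩ : ∃ e : Fin 4 → ℕ, StrictMono e ∧ ∀ k, e k ∈ profile F f := by
    obtain ⟨t, ht, htc⟩ := exists_subset_card_eq h
    exact ⟨t.orderEmbOfFin htc, (t.orderEmbOfFin htc).strictMono,
      fun k ↦ ht (t.orderEmbOfFin_mem htc k)⟩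
  obtain ⟨hm, he⟩ := he
  simp only [mem_profile] at he
  have hne (k l : Fin 4) (hkl : k ≠ l) : f.initial (e k) ≠ f.initial (e l) :=
    initial_ne f f (he k).1 (he l).1 (hm.injective.ne hkl)
  have hle (k l : Fin 4) (hkl : k ≤ l) := f.initial_mono (hm.monotone hkl)
  exact hF _ (he 0).2 _ (he 1).2 _ (he 2).2 _ (he 3).2 (hne _ _ (by decide)) (hne _ _ (by decide))
    (hne _ _ (by decide)) (hne _ _ (by decide)) (hne _ _ (by decide)) (hne _ _ (by decide))
    (union_subset (subset_inter (hle _ _ (by decide)) (hle _ _ (by decide)))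
      (subset_inter (hle _ _ (by decide)) (hle _ _ (by decide))))

/-- A member of a butterfly-free family lying strictly between two others determines them. -/
lemma eq_or_eq_or_eq_of_mem_profile (hF : ButterflyFree F) (hab : a < b) (hbc : b < c)
    (ha : a ∈ profile F f) (hb : b ∈ profile F f) (hc : c ∈ profile F f)
    (hg : g.initial b = f.initial b) (hi : i ∈ profile F g) :
    i = b ∨ (i = a ∧ g.initial a = f.initial a) ∨ (i = c ∧ g.initial c = f.initial c) := by
  rw [mem_profile] at ha hb hc hi
  have hAB := f.initial_mono hab.le
  have hBC := f.initial_mono hbc.le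
  have nAB := initial_ne f f ha.1 hb.1 hab.ne
  have nBC := initial_ne f f hb.1 hc.1 hbc.ne
  have nAC := initial_ne f f ha.1 hc.1 (hab.trans hbc).ne
  obtain h | rfl | h := lt_trichotomy i b
  · have hI : g.initial i ⊆ f.initial b := hg ▸ g.initial_mono h.le
    have e : g.initial i = f.initial a := by
      by_contra e
      exact hF _ hi.2 _ ha.2 _ hb.2 _ hc.2 e (initial_ne g f hi.1 hb.1 h.ne)
        (initial_ne g f hi.1 hc.1 (h.trans hbc).ne) nAB nAC nBC
        (union_subset (subset_inter hI (hI.trans hBC)) (subset_inter hAB (hAB.trans hBC)))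
    have hia : i = a := by rw [← card_initial g hi.1, e, card_initial f ha.1]
    exact .inr (.inl ⟨hia, hia ▸ e⟩)
  · exact .inl rfl
  · have hI : f.initial b ⊆ g.initial i := hg ▸ g.initial_mono h.le
    have e : g.initial i = f.initial c := by
      by_contra e
      exact hF _ ha.2 _ hb.2 _ hc.2 _ hi.2 nAB nAC
        (initial_ne f g ha.1 hi.1 (hab.trans h).ne) nBC (initial_ne f g hb.1 hi.1 h.ne) (Ne.symm e)
        (union_subset (subset_inter (hAB.trans hBC) (hAB.trans hI)) (subset_inter hBC hI))
    have hic : i = c := by rw [← card_initial g hi.1, e, card_initial f hc.1]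
    exact .inr (.inr ⟨hic, hic ▸ e⟩)

lemma profile_eq_singleton (hF : ButterflyFree F) (hab : a < b) (hbc : b < c)
    (ha : a ∈ profile F f) (hb : b ∈ profile F f) (hc : c ∈ profile F f)
    (hgb : g.initial b = f.initial b) (hga : g.initial a ≠ f.initial a)
    (hgc : g.initial c ≠ f.initial c) : profile F g = {b} := by
  ext i
  rw [mem_singleton]
  constructor
  · intro hi
    have := eq_or_eq_or_eq_of_mem_profile hF hab hbc ha hb hc hgb hi
    tauto
  · rintro rfl
    rw [mem_profile] at hb ⊢
    rwa [hgb]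

lemma pos_of_mem_profile (h0 : ∅ ∉ F) (hi : i ∈ profile F f) : 0 < i := by
  rw [mem_profile] at hi
  refine Nat.pos_of_ne_zero fun h ↦ h0 ?_
  have : f.initial i = ∅ := by ext; simp [h]
  exact this ▸ hi.2

lemma lt_card_of_mem_profile (h1 : univ ∉ F) (hi : i ∈ profile F f) : i < Fintype.card X := by
  rw [mem_profile] at hi
  refine lt_of_le_of_ne hi.1 fun h ↦ h1 ?_
  have : f.initial i = univ := by ext; simp [h]
  exact this ▸ hi.2

lemma card_filter_three_lt_card_filter_one (hF : ButterflyFree F) (h0 : ∅ ∉ F) (h1 : univ ∉ F)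
    (hX : 5 ≤ Fintype.card X) (hf : 3 ≤ #(profile F f)) :
    #{f : Numbering X | 3 ≤ #(profile F f)} < #{f : Numbering X | #(profile F f) = 1} := by
  have : NeZero (Fintype.card X) := ⟨by omega⟩
  have key : ∀ f : Numbering X, 3 ≤ #(profile F f) →
      ∃ (b : Fin (Fintype.card X)) (a c : ℕ), a < b.1 ∧ b.1 < c ∧
        a ∈ profile F f ∧ b.1 ∈ profile F f ∧ c ∈ profile F f := by
    intro f h
    obtain ⟨t, ht, htc⟩ := exists_subset_card_eq h
    have hm := (t.orderEmbOfFin htc).strictMono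
    have hmem k := ht (t.orderEmbOfFin_mem htc k)
    exact ⟨⟨_, lt_card_of_mem_profile h1 (hmem 1)⟩, _, _, hm (by decide : (0 : Fin 3) < 1),
      hm (by decide : (1 : Fin 3) < 2), hmem 0, hmem 1, hmem 2⟩
  choose! b a c hab hbc ha hb hc using key
  have rot (f : Numbering X) (h : 3 ≤ #(profile F f)) :
      profile F (f.trans (splitRotate (b f))) = {(b f).1} := by
    refine profile_eq_singleton hF (hab f h) (hbc f h) (ha f h) (hb f h) (hc f h)
      (initial_trans_eq_iff.2 (splitRotate_lt_iff _)) ?_ ?_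
    · rw [Ne, initial_trans_eq_iff]
      exact splitRotate_not_preserves (pos_of_mem_profile h0 (ha f h)) (hab f h).ne
        (lt_card_of_mem_profile h1 (ha f h))
    · rw [Ne, initial_trans_eq_iff]
      exact splitRotate_not_preserves (pos_of_mem_profile h0 (hc f h)) (hbc f h).ne'
        (lt_card_of_mem_profile h1 (hc f h))
  have rot_symm : profile F (f.trans (splitRotate (b f)).symm) = {(b f).1} := by
    have hsymm (i : ℕ) : initial (f.trans (splitRotate (b f)).symm) i = f.initial i ↔
        ∀ j, (splitRotate (b f) j).1 < i ↔ j.1 < i := by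
      rw [initial_trans_eq_iff, (splitRotate (b f)).symm.forall_congr_left]
      simp [Iff.comm]
    refine profile_eq_singleton hF (hab f hf) (hbc f hf) (ha f hf) (hb f hf) (hc f hf)
      ((hsymm _).2 (splitRotate_lt_iff _)) ?_ ?_
    · rw [Ne, hsymm]
      exact splitRotate_not_preserves (pos_of_mem_profile h0 (ha f hf)) (hab f hf).ne
        (lt_card_of_mem_profile h1 (ha f hf))
    · rw [Ne, hsymm]
      exact splitRotate_not_preserves (pos_of_mem_profile h0 (hc f hf)) (hbc f hf).ne'
        (lt_card_of_mem_profile h1 (hc f hf))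
  by_contra! hcard
  have hsurj := surjOn_of_injOn_of_card_le
    (s := ({f : Numbering X | 3 ≤ #(profile F f)} : Finset _))
    (t := ({f : Numbering X | #(profile F f) = 1} : Finset _))
    (fun f : Numbering X ↦ f.trans (splitRotate (b f)))
    (fun f h ↦ by
      simp only [coe_filter, mem_univ, true_and, Set.mem_ofPred_eq] at h ⊢
      rw [rot f h, card_singleton])
    (fun f h g h' e ↦ by
      simp only [coe_filter, mem_univ, true_and, Set.mem_ofPred_eq] at h h' e
      have hbb : b f = b g := by
        have := rot f h
        rw [e, rot g h', singleton_inj] at this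
        exact Fin.ext this.symm
      rw [hbb] at e
      ext x
      exact congrArg Fin.val ((splitRotate (b g)).injective (Equiv.congr_fun e x))) hcard
  obtain ⟨h, hh, e⟩ := @hsurj (f.trans (splitRotate (b f)).symm) (by simp [rot_symm])
  simp only [coe_filter, mem_univ, true_and, Set.mem_ofPred_eq] at hh e
  have hbb : b h = b f := by
    have := rot h hh
    rw [e, rot_symm, singleton_inj] at this
    exact Fin.ext this.symm
  have hfh : f = h.trans ((splitRotate (b f)).trans (splitRotate (b f))) := by
    rw [← Equiv.trans_assoc, ← hbb, e, hbb, Equiv.trans_assoc, Equiv.symm_trans_self,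
      Equiv.trans_refl]
  have hini (i : ℕ) : f.initial i = h.initial i ↔
      ∀ j, (splitRotate (b f) (splitRotate (b f) j)).1 < i ↔ j.1 < i := by
    have := initial_trans_eq_iff (f := h) (i := i)
      (e := (splitRotate (b f)).trans (splitRotate (b f)))
    rwa [← hfh] at this
  have hB : h.initial (b f) = f.initial (b f) := by
    refine ((hini _).2 fun j ↦ ?_).symm
    exact (splitRotate_lt_iff _ _).trans (splitRotate_lt_iff _ _)
  have hA : h.initial (a f) = f.initial (a f) := by
    have h₁ := hab f hf
    have h₂ := hbc f hf
    have h₃ := hab h hh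
    have := eq_or_eq_or_eq_of_mem_profile hF h₁ h₂ (ha f hf) (hb f hf) (hc f hf) hB (ha h hh)
    rw [hbb] at h₃
    rcases this with h | h | h
    · omega
    · exact h.2
    · omega
  have hC : h.initial (c f) = f.initial (c f) := by
    have h₁ := hab f hf
    have h₂ := hbc f hf
    have h₃ := hbc h hh
    have := eq_or_eq_or_eq_of_mem_profile hF h₁ h₂ (ha f hf) (hb f hf) (hc f hf) hB (hc h hh)
    rw [hbb] at h₃
    rcases this with h | h | h
    · omega
    · omega
    · exact h.2
  rw [eq_comm, hini] at hA hC
  have h₁ := hab f hf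
  have h₂ := hbc f hf
  have := eq_of_splitRotate_sq_preserves (pos_of_mem_profile h0 (ha f hf)) h₁.ne
    (lt_card_of_mem_profile h1 (ha f hf)) hA
  have := eq_of_splitRotate_sq_preserves (pos_of_mem_profile h0 (hc f hf)) h₂.ne'
    (lt_card_of_mem_profile h1 (hc f hf)) hC
  omega

lemma card_profile_eq_two (hF : ButterflyFree F) (h0 : ∅ ∉ F) (h1 : univ ∉ F)
    (hX : 5 ≤ Fintype.card X)
    (hsum : ∑ s ∈ F, (1 : ℚ) / ((Fintype.card X).choose #s) = 2) (f : Numbering X) :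
    #(profile F f) = 2 := by
  have htotal : ∑ f : Numbering X, #(profile F f) = ∑ _f : Numbering X, 2 := by
    have := sum_card_profile F
    rw [hsum] at this
    rw [sum_const, card_univ, smul_eq_mul]
    exact_mod_cast this
  have hle : ∀ f ∈ (univ : Finset (Numbering X)), #(profile F f) ≤ 2 := by
    by_contra! hex
    obtain ⟨f, -, hf⟩ := hex
    have hlt := card_filter_three_lt_card_filter_one hF h0 h1 hX hf
    have hpt : ∑ f : Numbering X, (#(profile F f) + if #(profile F f) = 1 then 1 else 0) ≤
        ∑ f : Numbering X, (2 + if 3 ≤ #(profile F f) then 1 else 0) := by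
      refine sum_le_sum fun f _ ↦ ?_
      have := card_profile_le_three hF f
      split_ifs <;> omega
    rw [sum_add_distrib, sum_add_distrib, htotal, ← card_filter, ← card_filter] at hpt
    omega
  exact (sum_eq_sum_iff_of_le hle).1 htotal f (mem_univ f)

/-- If all numberings have equally many prefixes in `F`, the sizes of these prefixes do not depend
on the numbering. -/
lemma profile_eq_profile {m : ℕ} (h : ∀ f : Numbering X, #(profile F f) = m)
    (f g : Numbering X) : profile F f = profile F g := by
  suffices H : ∀ (e : Equiv.Perm (Fin (Fintype.card X))) (f : Numbering X),
      profile F (f.trans e) = profile F f by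
    rw [← H (f.symm.trans g) f, ← Equiv.trans_assoc, Equiv.self_trans_symm, Equiv.refl_trans]
  intro e
  have he := Submonoid.mem_top e
  rw [← mclosure_adjacent_swap] at he
  induction he using Submonoid.closure_induction with
  | one => exact fun _ ↦ rfl
  | mul x y _ _ hx hy => exact fun f ↦ (hx (f.trans y)).trans (hy f)
  | mem x hx =>
    intro f
    obtain ⟨i, j, hij, rfl⟩ := hx
    set g : Numbering X := f.trans (Equiv.swap i j)
    have hini (k : ℕ) (hk : k ≠ j.1) : g.initial k = f.initial k := by
      refine initial_trans_eq_iff.2 fun l ↦ ?_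
      rw [Equiv.swap_apply_def]
      split_ifs with h₁ h₂
      · rw [h₁]; omega
      · rw [h₂]; omega
      · rfl
    have herase : (profile F g).erase j.1 = (profile F f).erase j.1 := by
      ext k
      simp only [mem_erase, mem_profile]
      exact and_congr_right fun hk ↦ by rw [hini k hk]
    have hmem : j.1 ∈ profile F g ↔ j.1 ∈ profile F f := by
      have hc := congrArg card herase
      rw [card_erase_eq_ite, card_erase_eq_ite, h f, h g] at hc
      have pos (f' : Numbering X) (hm : j.1 ∈ profile F f') : 0 < m :=
        h f' ▸ card_pos.2 ⟨_, hm⟩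
      split_ifs at hc with hg hf hf
      · exact iff_of_true hg hf
      · have := pos g hg
        omega
      · have := pos f hf
        omega
      · exact iff_of_false hg hf
    ext k
    obtain rfl | hk := eq_or_ne k j.1
    · exact hmem
    · rw [mem_profile, mem_profile, hini k hk]

lemma mem_iff_card_mem_profile {m : ℕ} (h : ∀ f : Numbering X, #(profile F f) = m)
    (f : Numbering X) (s : Finset X) : s ∈ F ↔ #s ∈ profile F f := by
  obtain ⟨g, hg⟩ := exists_initial_eq s
  rw [profile_eq_profile h f g, mem_profile, hg]
  simp [card_le_univ]

end Numbering

open Numbering in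
/-- Two full levels of a butterfly-free family are consecutive. -/
lemma ButterflyFree.level_le_succ {X : Type*} [Fintype X] [DecidableEq X] {F : Finset (Finset X)}
    (hF : ButterflyFree F) {k l : ℕ} (hk : 1 ≤ k) (hl : l < Fintype.card X)
    (hkF : ∀ s : Finset X, #s = k → s ∈ F) (hlF : ∀ s : Finset X, #s = l → s ∈ F) : l ≤ k + 1 := by
  by_contra! hkl
  let f : Numbering X := Fintype.equivFin X
  have hU := card_initial f (i := k + 1) (by omega)
  have hV := card_initial f (i := l - 1) (by omega)
  have hUV := f.initial_mono (i := k + 1) (j := l - 1) (by omega)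
  have hVc := card_compl (f.initial (l - 1))
  obtain ⟨x, hx, y, hy, hxy⟩ := one_lt_card.1 (show 1 < #(f.initial (k + 1)) by omega)
  obtain ⟨z, hz, w, hw, hzw⟩ := one_lt_card.1 (show 1 < #(f.initial (l - 1))ᶜ by omega)
  rw [mem_compl] at hz hw
  generalize f.initial (k + 1) = U at *
  generalize f.initial (l - 1) = V at *
  have cx := card_erase_of_mem hx
  have cy := card_erase_of_mem hy
  have cz := card_insert_of_notMem hz
  have cw := card_insert_of_notMem hw
  have ne {s t : Finset X} (h : #s ≠ #t) : s ≠ t := fun e ↦ h (congrArg card e)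
  refine hF (U.erase x) (hkF _ (by omega)) (U.erase y) (hkF _ (by omega)) (insert z V)
    (hlF _ (by omega)) (insert w V) (hlF _ (by omega)) ?_ (ne (by omega)) (ne (by omega))
    (ne (by omega)) (ne (by omega)) ?_ ?_
  · intro e
    have : x ∈ U.erase y := mem_erase.2 ⟨hxy, hx⟩
    rw [← e] at this
    exact notMem_erase x U this
  · intro e
    have : z ∈ insert w V := e ▸ mem_insert_self z V
    exact (mem_insert.1 this).elim hzw hz
  · exact (union_subset (erase_subset x U) (erase_subset y U)).trans
      (hUV.trans (subset_inter (subset_insert z V) (subset_insert w V)))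

open Numbering in
theorem stmt_9 (n : ℕ) (hn : 5 ≤ n) (F : Finset (Finset (Fin n)))
    (hempty : ∅ ∉ F) (hfull : (Finset.univ : Finset (Fin n)) ∉ F)
    (hstar : ∀ A ∈ F, ∀ B ∈ F, ∀ C ∈ F, ∀ D ∈ F,
      A ≠ B → A ≠ C → A ≠ D → B ≠ C → B ≠ D → C ≠ D → ¬ (A ∪ B ⊆ C ∩ D))
    (hsum : ∑ S ∈ F, (1 : ℚ) / (n.choose S.card) = 2) :
    ∃ k, 1 ≤ k ∧ k ≤ n - 2 ∧
      F = Finset.powersetCard k (Finset.univ : Finset (Fin n))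
        ∪ Finset.powersetCard (k + 1) (Finset.univ : Finset (Fin n)) := by
  have hF : ButterflyFree F := hstar
  have htwo := card_profile_eq_two hF hempty hfull (by simpa using hn) (by simpa using hsum)
  let f : Numbering (Fin n) := Fintype.equivFin (Fin n)
  have hmem := mem_iff_card_mem_profile htwo f
  obtain ⟨k, l, hkl, hP⟩ : ∃ k l, k < l ∧ profile F f = {k, l} := by
    obtain ⟨k, l, hkl, hP⟩ := card_eq_two.1 (htwo f)
    obtain h | h := hkl.lt_or_gt
    · exact ⟨k, l, h, hP⟩
    · exact ⟨l, k, h, hP.trans (pair_comm k l)⟩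
  have hk : 0 < k := pos_of_mem_profile hempty (f := f) (by simp [hP])
  have hl : l < Fintype.card (Fin n) := lt_card_of_mem_profile hfull (f := f) (by simp [hP])
  have hlk : l ≤ k + 1 := hF.level_le_succ hk hl (fun s hs ↦ by simp [hmem, hP, hs])
    (fun s hs ↦ by simp [hmem, hP, hs])
  obtain rfl : l = k + 1 := by omega
  rw [Fintype.card_fin] at hl
  refine ⟨k, hk, by omega, ?_⟩
  ext s
  simp [hmem, hP]
end
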